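/- Let i ≥ −1, let 1 ≤ t ≤ n−1, and suppose C̃ ∈ N_i(n−t). A t-tuple (r_1, …, r_t) yields a well-defined composition (φ_{i,n−1}^{r_1} ∘ φ_{i,n−2}^{r_2} ∘ ⋯ ∘ φ_{i,n−t}^{r_t})(C̃) (each factor applied within its domain) if and only if 0 ≤ r_1 ≤ r_2 ≤ ⋯ ≤ r_t ≤ n−t+i, and the number of such t-tuples is C(n+i, t). Moreover, for such a t-tuple and C = (φ_{i,n−1}^{r_1} ∘ ⋯ ∘ φ_{i,n−t}^{r_t})(C̃), the set {j : C has a j⁺-full-set} equals {r_1+1, r_2+2, …, r_t+t}, a t-element subset of [n+i] uniquely determined by (r_1, …, r_t). -/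

import Mathlib

/-!
Common definitions for formalizing "A recursion on maximal chains in the Tamari lattices"
(L. Nelson).

* Young diagrams are encoded by their row-length functions `lam : ℕ → ℕ` (rows indexed from 1,
  with `lam 0 = 0`).
* Dyck paths are lists of steps (north/east).
* Tableaux are encoded by entry functions `f : ℕ × ℕ → ℕ` (1-indexed boxes; value `0` means
  "no box").  The label of box `(x, y)` is `f (x, y)`.
-/

noncomputable section

namespace TamariMaxChains

/-- A step of a lattice path: north or east. -/
inductive Step : Type
  | N : Step
  | E : Step
deriving DecidableEq

/-- Number of north steps of a path. -/
def nCount (p : List Step) : ℕ := p.count Step.N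

/-- Number of east steps of a path. -/
def eCount (p : List Step) : ℕ := p.count Step.E

/-- `p` is a Dyck path: equally many norths and easts, and every prefix has at least as many
north steps as east steps (the path never goes below the diagonal `y = x`). -/
def IsDyck (p : List Step) : Prop :=
  nCount p = eCount p ∧ ∀ q : List Step, q <+: p → eCount q ≤ nCount q

/-- `q` is a prime Dyck path: it meets the slope-one line joining its endpoints only at its
endpoints. -/
def IsPrimeDyck (q : List Step) : Prop :=
  q ≠ [] ∧ nCount q = eCount q ∧
    ∀ s : List Step, s <+: q → s ≠ [] → s ≠ q → eCount s < nCount s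

/-- Covering relation of the Tamari lattice on Dyck paths:  `TamariCoverD P' P` means `P'`
covers `P`, i.e. `P'` is obtained from `P` by swapping an east step that is followed by a north
step with the prime Dyck subpath following it. -/
def TamariCoverD (P' P : List Step) : Prop :=
  ∃ a q b : List Step, IsPrimeDyck q ∧
    P = a ++ Step.E :: (q ++ b) ∧ P' = a ++ (q ++ Step.E :: b)

/-- `lam` is the row-length function of a Young diagram: rows are indexed from `1`,
`lam x` is the number of boxes in row `x`, rows weakly decrease, finitely many boxes. -/
def IsDiagram (lam : ℕ → ℕ) : Prop :=
  lam 0 = 0 ∧ (∀ x, 1 ≤ x → lam (x + 1) ≤ lam x) ∧ ∃ N, ∀ x, N ≤ x → lam x = 0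

/-- The height (number of north steps) of the prime path of row `d ≥ 1` of the Young diagram
with row lengths `lam`:  the least `t ≥ 1` such that either `t = d` (row `0` being regarded as
an infinite row of boxes) or row `d - t` has length at least `lam d + t`. -/
def primeHeight (lam : ℕ → ℕ) (d : ℕ) : ℕ :=
  sInf {t | 1 ≤ t ∧ (t = d ∨ (t < d ∧ lam d + t ≤ lam (d - t)))}

/-- The last box of row `d` is a corner box (last box of its row and lowest box of
its column). -/
def IsCorner (lam : ℕ → ℕ) (d : ℕ) : Prop := 1 ≤ d ∧ 1 ≤ lam d ∧ lam (d + 1) < lam d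

/-- The result of removing the `B`-strip of the last box `B` of row `d`: the last box of each of
the rows `d - h + 1, …, d` is removed, where `h` is the height of the prime path of row `d`. -/
def removeStrip (lam : ℕ → ℕ) (d : ℕ) : ℕ → ℕ := fun x =>
  if d + 1 ≤ x + primeHeight lam d ∧ x ≤ d then lam x - 1 else lam x

/-- Covering relation of the Tamari lattice on Young diagrams:  `mu` covers `lam` iff `mu` is
obtained from `lam` by removing the `B`-strip of a corner box `B`. -/
def TamariCoverY (mu lam : ℕ → ℕ) : Prop := ∃ d, IsCorner lam d ∧ mu = removeStrip lam d

/-- The `B`-strip of the last box `B` of row `d`: the set of last boxes of rows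
`d - h + 1, …, d`, where `h` is the height of the prime path of row `d`. -/
def stripSet (lam : ℕ → ℕ) (d : ℕ) : Set (ℕ × ℕ) :=
  {b | b.2 = lam b.1 ∧ 1 ≤ b.2 ∧ d + 1 ≤ b.1 + primeHeight lam d ∧ b.1 ≤ d}

/-- The enclosure of the `B`-strip of the last box `B = (d, lam d)` of row `d`: all boxes
`(x, y)` with `d - h ≤ x ≤ d` and `lam d ≤ y ≤ lam d + h`, where row `0` is regarded as an
infinite row of boxes. -/
def enclosure (lam : ℕ → ℕ) (d : ℕ) : Set (ℕ × ℕ) :=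
  {b | (b.1 = 0 ∨ b.2 ≤ lam b.1) ∧ 1 ≤ b.2 ∧
    d ≤ b.1 + primeHeight lam d ∧ b.1 ≤ d ∧ lam d ≤ b.2 ∧ b.2 ≤ lam d + primeHeight lam d}

/-- The Dyck path of length `2 n` corresponding to the Young diagram `lam` contained in the
staircase `δ_{n-1}` (the Dyck path is the silhouette of the Young diagram). -/
def toDyck (n : ℕ) (lam : ℕ → ℕ) : List Step :=
  ((List.range n).flatMap fun k =>
    List.replicate (lam (n - k) - lam (n - k + 1)) Step.E ++ [Step.N]) ++
    List.replicate (n - lam 1) Step.E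

/-- The prime path of row `d` of the Young diagram `lam`, as its list of steps (read from its
lower-left endpoint). -/
def primePathList (lam : ℕ → ℕ) (d : ℕ) : List Step :=
  Step.N :: ((((List.range (primeHeight lam d - 1)).flatMap fun j =>
    List.replicate (lam (d - 1 - j) - lam (d - j)) Step.E ++ [Step.N])) ++
    List.replicate (lam d + primeHeight lam d - lam (d - (primeHeight lam d - 1))) Step.E)

/-- `S` translates to `S'` by `p` units down and `q` units to the right. -/
def TranslatesBy (p q : ℤ) (S S' : Set (ℕ × ℕ)) : Prop :=
  ∀ x y : ℕ, (x, y) ∈ S' ↔ ∃ a b : ℕ, (a, b) ∈ S ∧ (x : ℤ) = a + p ∧ (y : ℤ) = b + q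

/-- `S` translates to `S'`. -/
def Translates (S S' : Set (ℕ × ℕ)) : Prop := ∃ p q : ℤ, TranslatesBy p q S S'

/-- The length of a tableau: its number of distinct labels (for an honest tableau, labels are
exactly `1, …, tlen f`). -/
def tlen (f : ℕ × ℕ → ℕ) : ℕ := sSup {v | v ≠ 0 ∧ ∃ b, f b = v}

/-- The number of boxes in row `x` of a tableau. -/
def rowLen (f : ℕ × ℕ → ℕ) (x : ℕ) : ℕ := sSup {y | f (x, y) ≠ 0}

/-- The number of boxes in column `y` of a tableau. -/
def colLen (f : ℕ × ℕ → ℕ) (y : ℕ) : ℕ := sSup {x | f (x, y) ≠ 0}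

/-- `f` is (the entry function of) a tableau: the support is a Young diagram (1-indexed),
rows strictly increase, columns weakly increase, and the set of labels is exactly
`{1, …, tlen f}`. -/
def IsTableau (f : ℕ × ℕ → ℕ) : Prop :=
  (∀ y, f (0, y) = 0) ∧ (∀ x, f (x, 0) = 0) ∧
  {b : ℕ × ℕ | f b ≠ 0}.Finite ∧
  (∀ x y x' y', 1 ≤ x' → x' ≤ x → 1 ≤ y' → y' ≤ y → f (x, y) ≠ 0 → f (x', y') ≠ 0) ∧
  (∀ x y, f (x, y) ≠ 0 → f (x, y + 1) ≠ 0 → f (x, y) < f (x, y + 1)) ∧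
  (∀ x y, f (x, y) ≠ 0 → f (x + 1, y) ≠ 0 → f (x, y) ≤ f (x + 1, y)) ∧
  (∀ v, 1 ≤ v → (v ≤ tlen f ↔ ∃ b, f b = v))

/-- `T^(r)`: the subtableau of all entries at most `r`. -/
def trunc (f : ℕ × ℕ → ℕ) (r : ℕ) : ℕ × ℕ → ℕ := fun b => if f b ≤ r then f b else 0

/-- The shape (row-length function) of a tableau. -/
def shapeOf (f : ℕ × ℕ → ℕ) : ℕ → ℕ := fun x => rowLen f x

/-- The row index of the end-box of the `k`-set of `f` (the maximal row index of a box
labeled `k`). -/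
def endRow (f : ℕ × ℕ → ℕ) (k : ℕ) : ℕ := sSup {x | ∃ y, f (x, y) = k}

/-- `Y 0 ⋗ Y 1 ⋗ ⋯ ⋗ Y l` is a saturated chain in the Tamari order on Young diagrams whose
maximal element `Y 0` is the empty diagram (each `Y r` covers `Y (r+1)`). -/
def IsTamariChain (Y : ℕ → ℕ → ℕ) (l : ℕ) : Prop :=
  (∀ r, r ≤ l → IsDiagram (Y r)) ∧ (∀ x, Y 0 x = 0) ∧
    ∀ r, r < l → TamariCoverY (Y r) (Y (r + 1))

/-- The tableau `ψ(C)` of the saturated chain `C = (∅ = Y 0 ⋗ ⋯ ⋗ Y l)`: the boxes removed in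
the transition `Y (r-1) ⋗ Y r` are labeled `r`; that is, each box of `Y l` is labeled by the
least `r` such that the box belongs to `Y r`. -/
def psiFun (Y : ℕ → ℕ → ℕ) (l : ℕ) : ℕ × ℕ → ℕ := fun b =>
  if 1 ≤ b.1 ∧ 1 ≤ b.2 ∧ b.2 ≤ Y l b.1 then sInf {r | r ≤ l ∧ b.2 ≤ Y r b.1} else 0

/-- `f` is a `ψ`-tableau: it is in the image of `ψ`. -/
def IsPsiTab (f : ℕ × ℕ → ℕ) : Prop :=
  ∃ l Y, IsTamariChain Y l ∧ f = psiFun Y l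

/-- Row lengths of the staircase shape `δ_{n-1} = (n-1, n-2, …, 1)`: row `x ≥ 1` has `n - x`
boxes. -/
def dstair (n : ℕ) : ℕ → ℕ := fun x => if x = 0 then 0 else n - x

/-- `C_i(n)`, via `ψ`: the set of maximal chains of length `n + i` in the Tamari lattice `T_n`,
identified with the `ψ`-tableaux of length `n + i` and shape `δ_{n-1}`. -/
def MemC (i : ℤ) (n : ℕ) (f : ℕ × ℕ → ℕ) : Prop :=
  IsTableau f ∧ IsPsiTab f ∧ (∀ x, rowLen f x = dstair n x) ∧ (tlen f : ℤ) = (n : ℤ) + i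

/-- The `r`-set of `f` (of shape `δ_{n-1}`) is a full-set with end-box `(k, n - k)`:
it begins in row `1` and ends in the outer diagonal, at the box `(k, n - k)`. -/
def HasFullSetAt (f : ℕ × ℕ → ℕ) (n r k : ℕ) : Prop :=
  (∃ y, f (1, y) = r) ∧ 1 ≤ k ∧ k ≤ n - 1 ∧ f (k, n - k) = r ∧
    ∀ x y, f (x, y) = r → x ≤ k

/-- `f` has an `r`-full-set. -/
def HasFullSet (f : ℕ × ℕ → ℕ) (n r : ℕ) : Prop := ∃ k, HasFullSetAt f n r k

/-- `f` has an `r⁺`-full-set (plus-full-set): an `r`-full-set whose end-box `(k, n-k)` satisfies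
`k = n - 1`, or `k ≤ n - 2` and the southwest neighbor has a smaller label. -/
def HasPlusFullSet (f : ℕ × ℕ → ℕ) (n r : ℕ) : Prop :=
  ∃ k, HasFullSetAt f n r k ∧ (k = n - 1 ∨ (k ≤ n - 2 ∧ f (k + 1, n - k - 1) < r))

/-- `F_i^r(n)`: the set of `C ∈ C_i(n)` whose `r`-set is a plus-full-set and whose `j`-set is
not a plus-full-set for any `j ∈ [r-1]`. -/
def MemF (i : ℤ) (n : ℕ) (r : ℕ) (f : ℕ × ℕ → ℕ) : Prop :=
  MemC i n f ∧ HasPlusFullSet f n r ∧ ∀ j, 1 ≤ j → j < r → ¬ HasPlusFullSet f n j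

/-- `N_i(n)`: the set of `C ∈ C_i(n)` having no plus-full-sets. -/
def MemN (i : ℤ) (n : ℕ) (f : ℕ × ℕ → ℕ) : Prop :=
  MemC i n f ∧ ∀ r, ¬ HasPlusFullSet f n r

/-- `α_d`: shift all rows of index greater than `d` down one row and repeat row `d` in
row `d + 1`. -/
def alphaFun (d : ℕ) (f : ℕ × ℕ → ℕ) : ℕ × ℕ → ℕ := fun b =>
  if b.1 ≤ d then f b else f (b.1 - 1, b.2)

/-- `β_d`: append a box labeled `tlen f + 1` at the end of each of the rows `1, …, d`. -/
def betaFun (d : ℕ) (f : ℕ × ℕ → ℕ) : ℕ × ℕ → ℕ := fun b =>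
  if 1 ≤ b.1 ∧ b.1 ≤ d ∧ b.2 = rowLen f b.1 + 1 then tlen f + 1 else f b

/-- The number of boxes of row `x` of `f` whose label is at most `r` (these occupy an initial
segment of the row). -/
def lowLen (f : ℕ × ℕ → ℕ) (r x : ℕ) : ℕ := sSup {y | f (x, y) ≠ 0 ∧ f (x, y) ≤ r}

/-- The row index `d` used in the definition of `Ĉ(r)`: the minimal `k ∈ [n-1]` with
`C (k, n-k) ≤ r` if such `k` exists, and `n` otherwise. -/
def hatD (f : ℕ × ℕ → ℕ) (n r : ℕ) : ℕ :=
  sInf ({k | 1 ≤ k ∧ k ≤ n - 1 ∧ 1 ≤ f (k, n - k) ∧ f (k, n - k) ≤ r} ∪ {n})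

/-- `Ĉ(r)` for `C ∈ C_i(n)` and `0 ≤ r ≤ n + i`: starting from `β_d(α_d(C^(r)))` (where `d` is
as in `hatD`), the entries of `C` greater than `r` of row index less than `d` are translated one
unit to the right, those of row index greater than `d` are translated one unit down, and all
these labels are incremented by one. -/
def hatFun (f : ℕ × ℕ → ℕ) (n r : ℕ) : ℕ × ℕ → ℕ := fun b =>
  let d := hatD f n r
  let x := b.1
  let y := b.2
  if x = 0 ∨ y = 0 then 0
  else if x ≤ d then
    if f (x, y) ≠ 0 ∧ f (x, y) ≤ r then f (x, y)
    else if y = lowLen f r x + 1 then r + 1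
    else if r < f (x, y - 1) then f (x, y - 1) + 1
    else 0
  else if x = d + 1 then f (d, y)
  else if f (x - 1, y) = 0 then 0
  else if f (x - 1, y) ≤ r then f (x - 1, y)
  else f (x - 1, y) + 1

/-- `RepBy i m t r C0 C` : `C = (φ_{i,m+t-1}^{r 1} ∘ φ_{i,m+t-2}^{r 2} ∘ ⋯ ∘ φ_{i,m}^{r t}) C0`,
each factor being applied within its domain. -/
def RepBy (i : ℤ) (m t : ℕ) (r : ℕ → ℕ) (C0 C : ℕ × ℕ → ℕ) : Prop :=
  ∃ D : ℕ → ℕ × ℕ → ℕ, D 0 = C0 ∧ D t = C ∧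
    ∀ s, s < t →
      MemC i (m + s) (D s) ∧
      ((r (t - s) : ℤ) ≤ (m : ℤ) + s + i) ∧
      (∀ j, 1 ≤ j → j ≤ r (t - s) → ¬ HasPlusFullSet (D s) (m + s) j) ∧
      D (s + 1) = hatFun (D s) (m + s) (r (t - s))

/-- The set `𝕏_{d,n-1}^r` of Theorem 4.3: `ψ`-tableaux of length `r`, contained in `δ_{n-1}`,
whose row `d` has length `n - d` and whose prime path of row `d` has height `d`. -/
def MemX (d n r : ℕ) (f : ℕ × ℕ → ℕ) : Prop :=
  IsTableau f ∧ IsPsiTab f ∧ tlen f = r ∧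
    (∀ x, 1 ≤ x → rowLen f x ≤ n - x) ∧
    rowLen f d = n - d ∧
    primeHeight (shapeOf f) d = d

/-- The set `ℤ_{d,n}^{r+1}` of Theorem 4.3: `ψ`-tableaux of length `r + 1`, contained in `δ_n`,
such that rows `d` and `d+1` of the truncation at `r` are identical, the end-box of the
`(r+1)`-set is `(d, n-d+1)`, and the prime path of `(d, n-d+1)` has height `d`. -/
def MemZ (d n r : ℕ) (g : ℕ × ℕ → ℕ) : Prop :=
  IsTableau g ∧ IsPsiTab g ∧ tlen g = r + 1 ∧
    (∀ x, 1 ≤ x → rowLen g x ≤ n + 1 - x) ∧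
    (∀ y, trunc g r (d, y) = trunc g r (d + 1, y)) ∧
    g (d, n - d + 1) = r + 1 ∧ (∀ x y, g (x, y) = r + 1 → x ≤ d) ∧
    primeHeight (shapeOf g) d = d

/-- One covering step, written with explicit strip rows `b+1, …, e`. -/
def St (mu lam : ℕ → ℕ) : Prop :=
  ∃ b e, b < e ∧ (b = 0 ∨ lam e + (e - b) ≤ lam b) ∧
    (∀ x, b < x → x < e → lam x < lam e + (e - x)) ∧ lam (e + 1) < lam e ∧
    ∀ x, lam x = if b < x ∧ x ≤ e then mu x + 1 else mu x

lemma diag_anti {lam : ℕ → ℕ} (h : IsDiagram lam) {x y : ℕ} (hx : 1 ≤ x) (hxy : x ≤ y) :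
    lam y ≤ lam x := by
  induction y, hxy using Nat.le_induction with
  | base => exact le_rfl
  | succ k hk ih => exact (h.2.1 k (by omega)).trans ih

lemma primeHeight_eq {lam : ℕ → ℕ} {b e : ℕ} (hbe : b < e)
    (h1 : b = 0 ∨ lam e + (e - b) ≤ lam b)
    (h2 : ∀ x, b < x → x < e → lam x < lam e + (e - x)) : primeHeight lam e = e - b := by
  unfold primeHeight
  apply le_antisymm
  · apply Nat.sInf_le
    refine ⟨by omega, ?_⟩
    rcases Nat.eq_zero_or_pos b with hb | hb
    · left; omega
    · right
      refine ⟨by omega, ?_⟩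
      rw [show e - (e - b) = b by omega]
      omega
  · apply le_csInf
    · exact ⟨e, by omega, Or.inl rfl⟩
    · rintro t ⟨ht, ht'⟩
      rcases ht' with rfl | ⟨ht1, ht2⟩
      · omega
      · by_contra hc
        have := h2 (e - t) (by omega) (by omega)
        omega

lemma cover_iff {mu lam : ℕ → ℕ} (hl : IsDiagram lam) : TamariCoverY mu lam ↔ St mu lam := by
  constructor
  · rintro ⟨e, ⟨he1, he2, he3⟩, rfl⟩
    have hmem : primeHeight lam e ∈ {t | 1 ≤ t ∧ (t = e ∨ (t < e ∧ lam e + t ≤ lam (e - t)))} :=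
      Nat.sInf_mem ⟨e, he1, Or.inl rfl⟩
    have hmin : ∀ t, 1 ≤ t → t < e → lam e + t ≤ lam (e - t) → primeHeight lam e ≤ t :=
      fun t h1 h2 h3 => Nat.sInf_le ⟨h1, Or.inr ⟨h2, h3⟩⟩
    obtain ⟨hp1, hp2⟩ := hmem
    set h := primeHeight lam e with hh
    have hle : h ≤ e := by omega
    refine ⟨e - h, e, by omega, ?_, ?_, he3, ?_⟩
    · rcases hp2 with hp2 | ⟨hp2, hp3⟩
      · left; omega
      · right; omega
    · intro x hx1 hx2
      by_contra hc
      have := hmin (e - x) (by omega) (by omega) (by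
        rw [show e - (e - x) = x by omega]; omega)
      omega
    · intro x
      unfold removeStrip
      rw [← hh]
      by_cases hx : e + 1 ≤ x + h ∧ x ≤ e
      · have := diag_anti hl (show 1 ≤ x by omega) hx.2
        rw [if_pos hx, if_pos (by omega)]
        omega
      · rw [if_neg hx, if_neg (by omega)]
  · rintro ⟨b, e, hbe, h1, h2, h3, h4⟩
    refine ⟨e, ⟨by omega, by omega, h3⟩, ?_⟩
    funext x
    have hp := primeHeight_eq hbe h1 h2
    unfold removeStrip
    rw [hp, h4 x]
    by_cases hx : b < x ∧ x ≤ e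
    · rw [if_pos hx, if_pos (by omega)]; omega
    · rw [if_neg hx, if_neg (by omega)]

/-- A chain together with its tableau. -/
structure Ch (Y : ℕ → ℕ → ℕ) (l : ℕ) (f : ℕ × ℕ → ℕ) : Prop where
  diag : ∀ j, j ≤ l → IsDiagram (Y j)
  zero : ∀ x, Y 0 x = 0
  step : ∀ j, j < l → St (Y j) (Y (j + 1))
  thr : ∀ x y j, j ≤ l → ((f (x, y) ≠ 0 ∧ f (x, y) ≤ j) ↔ (1 ≤ x ∧ 1 ≤ y ∧ y ≤ Y j x))
  bd : ∀ x y, f (x, y) ≤ l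

lemma St.le {mu lam : ℕ → ℕ} (h : St mu lam) (x : ℕ) : mu x ≤ lam x ∧ lam x ≤ mu x + 1 := by
  obtain ⟨b, e, -, -, -, -, h⟩ := h
  rw [h x]; split_ifs <;> omega

lemma mono_of_step {Y : ℕ → ℕ → ℕ} {l : ℕ} (h : ∀ j, j < l → St (Y j) (Y (j + 1)))
    {j k : ℕ} (hjk : j ≤ k) (hk : k ≤ l) (x : ℕ) : Y j x ≤ Y k x := by
  induction k, hjk using Nat.le_induction with
  | base => exact le_rfl
  | succ m hm ih => exact (ih (by omega)).trans ((h m (by omega)).le x).1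

lemma ch_of_chain {Y : ℕ → ℕ → ℕ} {l : ℕ} (h : IsTamariChain Y l) : Ch Y l (psiFun Y l) := by
  have hst : ∀ j, j < l → St (Y j) (Y (j + 1)) :=
    fun j hj => (cover_iff (h.1 _ (by omega))).1 (h.2.2 j hj)
  refine ⟨h.1, h.2.1, hst, ?_, ?_⟩
  · intro x y j hj
    unfold psiFun
    simp only
    by_cases hc : 1 ≤ x ∧ 1 ≤ y ∧ y ≤ Y l x
    · rw [if_pos hc]
      have hm : sInf {r | r ≤ l ∧ y ≤ Y r x} ∈ {r | r ≤ l ∧ y ≤ Y r x} :=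
        Nat.sInf_mem ⟨l, le_rfl, hc.2.2⟩
      obtain ⟨hm1, hm2⟩ := hm
      constructor
      · rintro ⟨-, h2⟩
        exact ⟨hc.1, hc.2.1, hm2.trans (mono_of_step hst h2 hj x)⟩
      · rintro ⟨h1, h2, h3⟩
        refine ⟨?_, Nat.sInf_le ⟨hj, h3⟩⟩
        intro h0
        rw [h0, h.2.1] at hm2
        omega
    · rw [if_neg hc]
      constructor
      · rintro ⟨h0, -⟩; exact absurd rfl h0
      · rintro ⟨h1, h2, h3⟩
        exact absurd ⟨h1, h2, h3.trans (mono_of_step hst hj le_rfl x)⟩ hc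
  · intro x y
    unfold psiFun
    simp only
    split_ifs with hc
    · exact Nat.sInf_le ⟨le_rfl, hc.2.2⟩
    · omega

namespace Ch
variable {Y : ℕ → ℕ → ℕ} {l : ℕ} {f : ℕ × ℕ → ℕ}

lemma mono (h : Ch Y l f) {j k : ℕ} (hjk : j ≤ k) (hk : k ≤ l) (x : ℕ) : Y j x ≤ Y k x :=
  mono_of_step h.step hjk hk x

lemma chain (h : Ch Y l f) : IsTamariChain Y l :=
  ⟨h.diag, h.zero, fun j hj => (cover_iff (h.diag _ (by omega))).2 (h.step j hj)⟩

lemma ne_zero (h : Ch Y l f) (x y : ℕ) : f (x, y) ≠ 0 ↔ (1 ≤ x ∧ 1 ≤ y ∧ y ≤ Y l x) := by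
  rw [← h.thr x y l le_rfl]
  exact ⟨fun h1 => ⟨h1, h.bd x y⟩, fun h1 => h1.1⟩

lemma eq_of (h : Ch Y l f) {g : ℕ × ℕ → ℕ} (hg : Ch Y l g) : f = g := by
  funext ⟨x, y⟩
  have h1 := h.thr x y (g (x, y)) (hg.bd x y)
  have h2 := hg.thr x y (g (x, y)) (hg.bd x y)
  have h3 := h.thr x y (f (x, y)) (h.bd x y)
  have h4 := hg.thr x y (f (x, y)) (h.bd x y)
  have h5 := h.ne_zero x y
  have h6 := hg.ne_zero x y
  by_cases hc : f (x, y) = 0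
  · by_cases hd : g (x, y) = 0
    · rw [hc, hd]
    · exact absurd hc (h5.2 (h6.1 hd))
  · have hd := h6.2 (h5.1 hc)
    have a := h1.2 (h2.1 ⟨hd, le_rfl⟩)
    have b := h4.2 (h3.1 ⟨hc, le_rfl⟩)
    omega

lemma psi (h : Ch Y l f) : IsPsiTab f := ⟨l, Y, h.chain, h.eq_of (ch_of_chain h.chain)⟩

/-- Characterization of the `j`-set. -/
lemma eq_iff (h : Ch Y l f) (x y j : ℕ) (hj : j < l) :
    f (x, y) = j + 1 ↔ (1 ≤ x ∧ 1 ≤ y ∧ y ≤ Y (j + 1) x ∧ Y j x < y) := by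
  have h1 := h.thr x y j hj.le
  have h2 := h.thr x y (j + 1) hj
  constructor
  · intro hf
    have := h2.1 ⟨by omega, by omega⟩
    refine ⟨this.1, this.2.1, this.2.2, ?_⟩
    by_contra hc
    have := h1.2 ⟨this.1, this.2.1, by omega⟩
    omega
  · rintro ⟨a, b, c, d⟩
    have h3 := h2.2 ⟨a, b, c⟩
    have h4 : ¬ (f (x, y) ≠ 0 ∧ f (x, y) ≤ j) := fun h5 => by
      have := (h1.1 h5).2.2; omega
    omega

lemma exists_label (h : Ch Y l f) (j : ℕ) (hj : j < l) : ∃ b, f b = j + 1 := by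
  obtain ⟨b, e, hbe, -, -, -, h4⟩ := h.step j hj
  refine ⟨(e, Y (j + 1) e), (h.eq_iff _ _ _ hj).2 ?_⟩
  have := h4 e
  rw [if_pos ⟨hbe, le_rfl⟩] at this
  omega

/-- Labels occupy contiguous rows. -/
lemma contig (h : Ch Y l f) {j x1 x2 x y1 y2 : ℕ} (hj : 1 ≤ j) (h1 : f (x1, y1) = j)
    (h2 : f (x2, y2) = j) (hx1 : x1 ≤ x) (hx2 : x ≤ x2) : ∃ y, f (x, y) = j := by
  have hjl : j ≤ l := by rw [← h1]; exact h.bd _ _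
  obtain ⟨k, rfl⟩ : ∃ k, j = k + 1 := ⟨j - 1, by omega⟩
  obtain ⟨b, e, hbe, -, -, -, h4⟩ := h.step k hjl
  rw [h.eq_iff _ _ _ hjl] at h1 h2
  refine ⟨Y (k + 1) x, (h.eq_iff _ _ _ hjl).2 ?_⟩
  have a1 := h4 x1
  have a2 := h4 x2
  have a := h4 x
  split_ifs at a1 a2 a <;> omega

lemma low (h : Ch Y l f) {r x : ℕ} (hr : r ≤ l) (hx : 1 ≤ x) : lowLen f r x = Y r x := by
  unfold lowLen
  have : {y | f (x, y) ≠ 0 ∧ f (x, y) ≤ r} = Set.Icc 1 (Y r x) := by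
    ext y
    simp only [Set.mem_ofPred_eq, Set.mem_Icc]
    rw [h.thr x y r hr]
    tauto
  rw [this]
  rcases Nat.eq_zero_or_pos (Y r x) with h0 | h0
  · rw [h0]; simp
  · exact csSup_Icc h0

lemma row (h : Ch Y l f) (x : ℕ) : rowLen f x = Y l x := by
  rcases Nat.eq_zero_or_pos x with rfl | hx
  · rw [(h.diag l le_rfl).1]
    unfold rowLen
    have : {y | f (0, y) ≠ 0} = ∅ := by
      ext y
      simp only [Set.mem_ofPred_eq, h.ne_zero, Set.mem_empty_iff_false, iff_false]
      omega
    rw [this]; simp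
  · rw [← h.low le_rfl hx]
    unfold rowLen lowLen
    congr 1
    ext y
    simp only [Set.mem_ofPred_eq]
    exact ⟨fun h1 => ⟨h1, h.bd x y⟩, fun h1 => h1.1⟩

lemma len (h : Ch Y l f) : tlen f = l := by
  unfold tlen
  have : {v | v ≠ 0 ∧ ∃ b, f b = v} = Set.Icc 1 l := by
    ext v
    simp only [Set.mem_ofPred_eq, Set.mem_Icc]
    constructor
    · rintro ⟨h0, ⟨x, y⟩, rfl⟩
      exact ⟨by omega, h.bd x y⟩
    · rintro ⟨h1, h2⟩
      obtain ⟨b, hb⟩ := h.exists_label (v - 1) (by omega)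
      exact ⟨by omega, b, by omega⟩
  rw [this]
  rcases Nat.eq_zero_or_pos l with h0 | h0
  · rw [h0]; simp
  · exact csSup_Icc h0

lemma tableau (h : Ch Y l f) : IsTableau f := by
  refine ⟨?_, ?_, ?_, ?_, ?_, ?_, ?_⟩
  · intro y
    by_contra hc
    have := (h.ne_zero _ _).1 hc
    omega
  · intro y
    by_contra hc
    have := (h.ne_zero _ _).1 hc
    omega
  · obtain ⟨N, hN⟩ := (h.diag l le_rfl).2.2
    apply (Set.finite_Icc ((0 : ℕ), (0 : ℕ)) (N, Y l 1)).subset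
    rintro ⟨x, y⟩ hb
    have hb := (h.ne_zero _ _).1 hb
    have h1 := diag_anti (h.diag l le_rfl) le_rfl hb.1
    have h2 := hN x
    simp only [Set.mem_Icc, Prod.mk_le_mk]
    omega
  · intro x y x' y' h1 h2 h3 h4 h5
    rw [h.ne_zero] at h5 ⊢
    have := diag_anti (h.diag l le_rfl) h1 h2
    omega
  · intro x y h1 h2
    by_contra hc
    have hb := h.bd x (y + 1)
    obtain ⟨k, hk⟩ : ∃ k, f (x, y + 1) = k + 1 := ⟨f (x, y + 1) - 1, by omega⟩
    have h3 := (h.eq_iff _ _ k (by omega)).1 hk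
    have h4 := (h.step k (by omega)).le x
    have h5 := (h.thr x y k (by omega)).2 ⟨h3.1, ((h.ne_zero _ _).1 h1).2.1, by omega⟩
    omega
  · intro x y h1 h2
    have hb := h.bd (x + 1) y
    have h3 := (h.thr (x + 1) y _ hb).1 ⟨h2, le_rfl⟩
    have h4 := (h.ne_zero _ _).1 h1
    have h5 := (h.diag _ hb).2.1 x h4.1
    exact ((h.thr x y _ hb).2 ⟨h4.1, h4.2.1, by omega⟩).2
  · intro v hv
    rw [h.len]
    constructor
    · intro h1
      obtain ⟨b, hb⟩ := h.exists_label (v - 1) (by omega)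
      exact ⟨b, by omega⟩
    · rintro ⟨⟨x, y⟩, rfl⟩
      exact h.bd x y

end Ch

lemma memC_iff {i : ℤ} {n : ℕ} {f : ℕ × ℕ → ℕ} :
    MemC i n f ↔ ∃ Y l, Ch Y l f ∧ (∀ x, Y l x = dstair n x) ∧ (l : ℤ) = n + i := by
  constructor
  · rintro ⟨-, ⟨l, Y, hY, rfl⟩, h3, h4⟩
    have hc := ch_of_chain hY
    refine ⟨Y, l, hc, fun x => ?_, ?_⟩
    · rw [← h3, hc.row]
    · rw [← h4, hc.len]
  · rintro ⟨Y, l, hc, h1, h2⟩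
    exact ⟨hc.tableau, hc.psi, fun x => by rw [hc.row, h1], by rw [hc.len, h2]⟩

/-- Prime height of row `d` equals `d`. -/
def HH (lam : ℕ → ℕ) (d : ℕ) : Prop := ∀ x, 1 ≤ x → x < d → lam x < lam d + (d - x)

lemma strip_zero {lam : ℕ → ℕ} {b e d : ℕ} (h1 : b = 0 ∨ lam e + (e - b) ≤ lam b)
    (h2 : ∀ x, b < x → x < e → lam x < lam e + (e - x)) (hd : HH lam d) (hb : b < d)
    (he : d ≤ e) : b = 0 := by
  by_contra hc
  have h3 := hd b (by omega) hb
  rcases he.lt_or_eq with he | rfl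
  · have := h2 d hb he
    omega
  · omega

lemma HH_step {mu lam : ℕ → ℕ} {d : ℕ} (h : St mu lam) (hd : HH lam d) : HH mu d := by
  obtain ⟨b, e, hbe, h1, h2, h3, h4⟩ := h
  intro x hx hxd
  have h5 := hd x hx hxd
  have hx4 := h4 x
  have hd4 := h4 d
  by_cases hc : b < d ∧ d ≤ e
  · have hb := strip_zero h1 h2 hd hc.1 hc.2
    rw [if_pos hc] at hd4
    rw [if_pos (by omega)] at hx4
    omega
  · rw [if_neg hc] at hd4
    split_ifs at hx4 <;> omega

lemma Ch.HH_all {Y : ℕ → ℕ → ℕ} {l : ℕ} {f : ℕ × ℕ → ℕ} (h : Ch Y l f) {j r d : ℕ}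
    (hjr : j ≤ r) (hr : r ≤ l) (hd : HH (Y r) d) : HH (Y j) d := by
  induction r, hjr using Nat.le_induction with
  | base => exact hd
  | succ m hm ih => exact ih (by omega) (HH_step (h.step m (by omega)) hd)

/-- Facts about the row index `hatD`. -/
structure DF (Y : ℕ → ℕ → ℕ) (n r d : ℕ) : Prop where
  pos : 1 ≤ d
  le : d ≤ n
  full : Y r d = n - d
  lt : ∀ x, 1 ≤ x → x < d → Y r x < n - x

lemma hatD_facts {Y : ℕ → ℕ → ℕ} {l n r : ℕ} {f : ℕ × ℕ → ℕ} (h : Ch Y l f)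
    (hs : ∀ x, Y l x = dstair n x) (hn : 1 ≤ n) (hr : r ≤ l) : DF Y n r (hatD f n r) := by
  have hle : ∀ x, 1 ≤ x → Y r x ≤ n - x := by
    intro x hx
    have h1 := h.mono hr le_rfl x
    rw [hs, dstair, if_neg (by omega)] at h1
    exact h1
  have hm : hatD f n r ∈ ({k | 1 ≤ k ∧ k ≤ n - 1 ∧ 1 ≤ f (k, n - k) ∧ f (k, n - k) ≤ r} ∪ {n}) :=
    Nat.sInf_mem ⟨n, Or.inr rfl⟩
  have hmin : ∀ k, k ∈ ({k | 1 ≤ k ∧ k ≤ n - 1 ∧ 1 ≤ f (k, n - k) ∧ f (k, n - k) ≤ r} ∪ {n}) →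
      hatD f n r ≤ k := fun k hk => Nat.sInf_le hk
  have hn' := hmin n (Or.inr rfl)
  have key : 1 ≤ hatD f n r ∧ Y r (hatD f n r) = n - hatD f n r := by
    rcases hm with ⟨h1, h2, h3, h4⟩ | h1
    · have h5 := (h.thr _ _ r hr).1 ⟨by omega, h4⟩
      have h6 := hle _ h1
      omega
    · have h1 : hatD f n r = n := h1
      rw [h1]
      have h6 := hle n hn
      omega
  refine ⟨key.1, hn', key.2, ?_⟩
  intro x hx hxd
  by_contra hc
  have h5 := (h.thr x (n - x) r hr).2 ⟨hx, by omega, by omega⟩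
  have := hmin x (Or.inl ⟨hx, by omega, by omega, h5.2⟩)
  omega

/-- The chain of `Ĉ(r)`. -/
def hatY (Y : ℕ → ℕ → ℕ) (d r : ℕ) : ℕ → ℕ → ℕ := fun j x =>
  if j ≤ r then (if x ≤ d then Y j x else Y j (x - 1))
  else (if x = 0 then 0 else if x ≤ d then Y (j - 1) x + 1 else Y (j - 1) (x - 1))

section hatYs
variable {Y : ℕ → ℕ → ℕ} {d r j x : ℕ}
lemma hatY_a (hj : j ≤ r) (hx : x ≤ d) : hatY Y d r j x = Y j x := by
  simp [hatY, hj, hx]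
lemma hatY_b (hj : j ≤ r) (hx : d < x) : hatY Y d r j x = Y j (x - 1) := by
  simp [hatY, hj, hx]
lemma hatY_c (hj : r < j) (h0 : 1 ≤ x) (hx : x ≤ d) : hatY Y d r j x = Y (j - 1) x + 1 := by
  simp [hatY, hj, hx, show x ≠ 0 by omega]
lemma hatY_d (hj : r < j) (hx : d < x) : hatY Y d r j x = Y (j - 1) (x - 1) := by
  simp [hatY, not_le.2 hj, not_le.2 hx, show x ≠ 0 by omega]
lemma hatY_0 (hj : r < j) : hatY Y d r j 0 = 0 := by
  simp [hatY, hj]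
end hatYs

lemma full_of_le {Y : ℕ → ℕ → ℕ} {l n r d j : ℕ} {f : ℕ × ℕ → ℕ} (h : Ch Y l f)
    (hs : ∀ x, Y l x = dstair n x) (hD : DF Y n r d) (hj : r ≤ j) (hjl : j ≤ l) :
    Y j d = n - d := by
  have h1 := h.mono hj hjl d
  have h2 := h.mono hjl le_rfl d
  have h3 := hD.pos
  rw [hs, dstair, if_neg (by omega)] at h2
  have := hD.full
  omega

lemma hat_diag {Y : ℕ → ℕ → ℕ} {l n r d : ℕ} {f : ℕ × ℕ → ℕ} (h : Ch Y l f)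
    (hD : DF Y n r d) (hr : r ≤ l) (j : ℕ) (hj : j ≤ l + 1) : IsDiagram (hatY Y d r j) := by
  have hpos := hD.pos
  rcases le_or_gt j r with hjr | hjr
  · have hd := h.diag j (by omega)
    refine ⟨?_, ?_, ?_⟩
    · rw [hatY_a hjr (by omega)]; exact hd.1
    · intro x hx
      rcases lt_trichotomy x d with hc | hc | hc
      · rw [hatY_a hjr (by omega), hatY_a hjr (by omega)]; exact hd.2.1 x hx
      · rw [hatY_b hjr (by omega), hatY_a hjr (by omega)]; exact le_rfl
      · rw [hatY_b hjr (by omega), hatY_b hjr (by omega)]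
        exact diag_anti hd (by omega) (by omega)
    · obtain ⟨N, hN⟩ := hd.2.2
      refine ⟨N + d + 1, fun x hx => ?_⟩
      rw [hatY_b hjr (by omega)]; exact hN _ (by omega)
  · have hd := h.diag (j - 1) (by omega)
    refine ⟨hatY_0 hjr, ?_, ?_⟩
    · intro x hx
      rcases lt_trichotomy x d with hc | hc | hc
      · rw [hatY_c hjr (by omega) (by omega), hatY_c hjr (by omega) (by omega)]
        have := hd.2.1 x hx
        omega
      · rw [hatY_d hjr (by omega), hatY_c hjr (by omega) (by omega)]
        simp
      · rw [hatY_d hjr (by omega), hatY_d hjr (by omega)]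
        exact diag_anti hd (by omega) (by omega)
    · obtain ⟨N, hN⟩ := hd.2.2
      refine ⟨N + d + 1, fun x hx => ?_⟩
      rw [hatY_d hjr (by omega)]; exact hN _ (by omega)

lemma hat_step {Y : ℕ → ℕ → ℕ} {l n r d : ℕ} {f : ℕ × ℕ → ℕ} (h : Ch Y l f)
    (hs : ∀ x, Y l x = dstair n x)
    (hD : DF Y n r d) (hr : r ≤ l) (j : ℕ) (hj : j < l + 1) :
    St (hatY Y d r j) (hatY Y d r (j + 1)) := by
  have hpos := hD.pos
  rcases lt_trichotomy j r with hjr | hjr | hjr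
  · -- old steps before `r`
    have hH : HH (Y (j + 1)) d := by
      refine h.HH_all (show j + 1 ≤ r by omega) hr ?_
      intro x hx hxd
      have h1 := hD.lt x hx hxd
      have h2 := hD.full
      have h3 := hD.le
      omega
    obtain ⟨b, e, hbe, h1, h2, h3, h4⟩ := h.step j (by omega)
    rcases lt_or_ge e d with hed | hed
    · refine ⟨b, e, hbe, ?_, ?_, ?_, ?_⟩
      · rw [hatY_a (by omega) (by omega), hatY_a (by omega) (by omega)]; exact h1
      · intro x hx1 hx2
        rw [hatY_a (by omega) (by omega), hatY_a (by omega) (by omega)]; exact h2 x hx1 hx2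
      · rw [hatY_a (by omega) (by omega), hatY_a (by omega) (by omega)]; exact h3
      · intro x
        rcases le_or_gt x d with hx | hx
        · rw [hatY_a (by omega) hx, hatY_a (by omega) hx]; exact h4 x
        · rw [hatY_b (by omega) hx, hatY_b (by omega) hx, if_neg (by omega), h4,
            if_neg (by omega)]
    · rcases lt_or_ge b d with hbd | hbd
      · have hb := strip_zero h1 h2 hH hbd hed
        subst hb
        refine ⟨0, e + 1, by omega, Or.inl rfl, ?_, ?_, ?_⟩
        · intro x hx1 hx2
          rw [hatY_b (x := e + 1) (by omega) (by omega)]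
          rcases le_or_gt x d with hx | hx
          · rw [hatY_a (by omega) hx]
            rcases lt_or_ge x e with hxe | hxe
            · have := h2 x hx1 hxe
              simp only [Nat.add_sub_cancel]
              omega
            · have : x = e := by omega
              subst this
              simp
          · rw [hatY_b (by omega) hx]
            have := h2 (x - 1) (by omega) (by omega)
            simp only [Nat.add_sub_cancel]
            omega
        · rw [hatY_b (by omega) (by omega), hatY_b (by omega) (by omega)]; exact h3
        · intro x
          rcases le_or_gt x d with hx | hx
          · rw [hatY_a (by omega) hx, hatY_a (by omega) hx, h4]
            split_ifs <;> omega
          · rw [hatY_b (by omega) hx, hatY_b (by omega) hx, h4]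
            split_ifs <;> omega
      · refine ⟨b + 1, e + 1, by omega, Or.inr ?_, ?_, ?_, ?_⟩
        · rw [hatY_b (by omega) (by omega), hatY_b (by omega) (by omega)]
          simp only [Nat.add_sub_cancel]
          omega
        · intro x hx1 hx2
          rw [hatY_b (by omega) (by omega), hatY_b (by omega) (by omega)]
          have := h2 (x - 1) (by omega) (by omega)
          simp only [Nat.add_sub_cancel]
          omega
        · rw [hatY_b (by omega) (by omega), hatY_b (by omega) (by omega)]; exact h3
        · intro x
          rcases le_or_gt x d with hx | hx
          · rw [hatY_a (by omega) hx, hatY_a (by omega) hx, h4]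
            split_ifs <;> omega
          · rw [hatY_b (by omega) hx, hatY_b (by omega) hx, h4]
            split_ifs <;> omega
  · -- the new step
    subst hjr
    refine ⟨0, d, by omega, Or.inl rfl, ?_, ?_, ?_⟩
    · intro x hx1 hx2
      rw [hatY_c (by omega) (by omega) (by omega), hatY_c (by omega) (by omega) (by omega)]
      have h1 := hD.lt x hx1 hx2
      have h2 := hD.full
      have h3 := hD.le
      simp only [Nat.add_sub_cancel]
      omega
    · rw [hatY_d (by omega) (by omega), hatY_c (by omega) (by omega) (by omega)]
      simp
    · intro x
      rcases Nat.eq_zero_or_pos x with rfl | hx0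
      · rw [hatY_0 (by omega), hatY_a (by omega) (by omega), if_neg (by omega)]
        exact (h.diag j hr).1.symm
      · rcases le_or_gt x d with hx | hx
        · rw [hatY_c (by omega) hx0 hx, hatY_a (by omega) hx, if_pos ⟨hx0, hx⟩]
          simp
        · rw [hatY_d (by omega) hx, hatY_b (by omega) hx, if_neg (by omega)]
          simp
  · -- old steps after `r`
    obtain ⟨k, rfl⟩ : ∃ k, j = k + 1 := ⟨j - 1, by omega⟩
    have f1 := full_of_le h hs hD (show r ≤ k by omega) (by omega)
    have f2 := full_of_le h hs hD (show r ≤ k + 1 by omega) (by omega)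
    obtain ⟨b, e, hbe, h1, h2, h3, h4⟩ := h.step k (by omega)
    have hnd : ¬ (b < d ∧ d ≤ e) := by
      intro hc
      have := h4 d
      rw [if_pos hc] at this
      omega
    rcases lt_or_ge e d with hed | hed
    · refine ⟨b, e, hbe, ?_, ?_, ?_, ?_⟩
      · rcases Nat.eq_zero_or_pos b with hb | hb
        · exact Or.inl hb
        · right
          rw [hatY_c (by omega) (by omega) (by omega), hatY_c (by omega) (by omega) (by omega)]
          simp only [Nat.add_sub_cancel]
          omega
      · intro x hx1 hx2
        rw [hatY_c (by omega) (by omega) (by omega), hatY_c (by omega) (by omega) (by omega)]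
        have := h2 x hx1 hx2
        simp only [Nat.add_sub_cancel]
        omega
      · rw [hatY_c (by omega) (by omega) (by omega), hatY_c (by omega) (by omega) (by omega)]
        simp only [Nat.add_sub_cancel]
        omega
      · intro x
        rcases Nat.eq_zero_or_pos x with rfl | hx0
        · rw [hatY_0 (by omega), hatY_0 (by omega), if_neg (by omega)]
        · rcases le_or_gt x d with hx | hx
          · rw [hatY_c (by omega) hx0 hx, hatY_c (by omega) hx0 hx]
            simp only [Nat.add_sub_cancel]
            rw [h4]
            split_ifs <;> omega
          · rw [hatY_d (by omega) hx, hatY_d (by omega) hx]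
            simp only [Nat.add_sub_cancel]
            rw [h4]
            split_ifs <;> omega
    · refine ⟨b + 1, e + 1, by omega, Or.inr ?_, ?_, ?_, ?_⟩
      · rw [hatY_d (by omega) (by omega), hatY_d (by omega) (by omega)]
        simp only [Nat.add_sub_cancel]
        omega
      · intro x hx1 hx2
        rw [hatY_d (by omega) (by omega), hatY_d (by omega) (by omega)]
        have := h2 (x - 1) (by omega) (by omega)
        simp only [Nat.add_sub_cancel]
        omega
      · rw [hatY_d (by omega) (by omega), hatY_d (by omega) (by omega)]; exact h3
      · intro x
        rcases Nat.eq_zero_or_pos x with rfl | hx0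
        · rw [hatY_0 (by omega), hatY_0 (by omega), if_neg (by omega)]
        · rcases le_or_gt x d with hx | hx
          · rw [hatY_c (by omega) hx0 hx, hatY_c (by omega) hx0 hx]
            simp only [Nat.add_sub_cancel]
            rw [h4]
            split_ifs <;> omega
          · rw [hatY_d (by omega) hx, hatY_d (by omega) hx]
            simp only [Nat.add_sub_cancel]
            rw [h4]
            split_ifs <;> omega

/-- Values of `hatFun` by region. -/
structure HV (Y : ℕ → ℕ → ℕ) (r d : ℕ) (f g : ℕ × ℕ → ℕ) : Prop where
  z1 : ∀ y, g (0, y) = 0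
  z2 : ∀ x, g (x, 0) = 0
  a : ∀ x y, 1 ≤ x → x ≤ d → 1 ≤ y → y ≤ Y r x → g (x, y) = f (x, y)
  b : ∀ x y, 1 ≤ x → x ≤ d → y = Y r x + 1 → g (x, y) = r + 1
  c : ∀ x y, 1 ≤ x → x ≤ d → Y r x + 1 < y →
    g (x, y) = if f (x, y - 1) = 0 then 0 else f (x, y - 1) + 1
  e : ∀ x y, d < x → 1 ≤ y →
    g (x, y) = if f (x - 1, y) ≤ r then f (x - 1, y) else f (x - 1, y) + 1

lemma hat_vals {Y : ℕ → ℕ → ℕ} {l n r : ℕ} {f : ℕ × ℕ → ℕ} (h : Ch Y l f)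
    (hs : ∀ x, Y l x = dstair n x) (hn : 1 ≤ n) (hr : r ≤ l) :
    HV Y r (hatD f n r) f (hatFun f n r) := by
  have hD := hatD_facts h hs hn hr
  have hpos := hD.pos
  constructor
  · intro y; simp [hatFun]
  · intro x; simp [hatFun]
  · intro x y h1 h2 h3 h4
    have := (h.thr x y r hr).2 ⟨h1, h3, h4⟩
    unfold hatFun
    simp only
    rw [if_neg (by omega), if_pos h2, if_pos this]
  · intro x y h1 h2 h3
    have : ¬ (f (x, y) ≠ 0 ∧ f (x, y) ≤ r) := fun hc => by
      have := (h.thr x y r hr).1 hc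
      omega
    unfold hatFun
    simp only
    rw [if_neg (by omega), if_pos h2, if_neg this, if_pos (by rw [h.low hr h1]; exact h3)]
  · intro x y h1 h2 h3
    have h5 : ¬ (f (x, y) ≠ 0 ∧ f (x, y) ≤ r) := fun hc => by
      have := (h.thr x y r hr).1 hc
      omega
    have h6 : ¬ (f (x, y - 1) ≠ 0 ∧ f (x, y - 1) ≤ r) := fun hc => by
      have := (h.thr x (y - 1) r hr).1 hc
      omega
    unfold hatFun
    simp only
    rw [if_neg (by omega), if_pos h2, if_neg h5, if_neg (by rw [h.low hr h1]; omega)]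
    split_ifs <;> omega
  · intro x y h1 h2
    unfold hatFun
    simp only
    rw [if_neg (by omega), if_neg (by omega)]
    by_cases hx : x = hatD f n r + 1
    · rw [if_pos hx]
      have h3 : f (hatD f n r, y) ≤ r := by
        by_contra hc
        have h4 := (h.ne_zero (hatD f n r) y).1 (by omega)
        rw [full_of_le h hs hD hr le_rfl, ← hD.full] at h4
        have := (h.thr _ _ r hr).2 h4
        omega
      rw [show x - 1 = hatD f n r by omega, if_pos h3]
    · rw [if_neg hx]
      split_ifs <;> omega

lemma hat_ch {Y : ℕ → ℕ → ℕ} {l n r : ℕ} {f : ℕ × ℕ → ℕ} (h : Ch Y l f)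
    (hs : ∀ x, Y l x = dstair n x) (hn : 1 ≤ n) (hr : r ≤ l) :
    Ch (hatY Y (hatD f n r) r) (l + 1) (hatFun f n r) := by
  have hD := hatD_facts h hs hn hr
  have hV := hat_vals h hs hn hr
  generalize hatD f n r = d at hD hV
  generalize hatFun f n r = g at hV
  have hpos := hD.pos
  refine ⟨hat_diag h hD hr, ?_, hat_step h hs hD hr, ?_, ?_⟩
  · intro x
    rcases le_or_gt x d with hx | hx
    · rw [hatY_a (by omega) hx, h.zero]
    · rw [hatY_b (by omega) hx, h.zero]
  · intro x y j hj
    rcases Nat.eq_zero_or_pos x with rfl | hx0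
    · rw [hV.z1]; omega
    rcases Nat.eq_zero_or_pos y with rfl | hy0
    · rw [hV.z2]; omega
    rcases le_or_gt x d with hx | hx
    · rcases lt_trichotomy y (Y r x + 1) with hy | hy | hy
      · rw [hV.a x y hx0 hx hy0 (by omega)]
        have hfr := (h.thr x y r hr).2 ⟨hx0, hy0, by omega⟩
        rcases le_or_gt j r with hjr | hjr
        · rw [hatY_a hjr hx]; exact h.thr x y j (by omega)
        · rw [hatY_c hjr hx0 hx]
          have := h.mono (show r ≤ j - 1 by omega) (by omega) x
          omega
      · rw [hV.b x y hx0 hx hy]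
        rcases le_or_gt j r with hjr | hjr
        · rw [hatY_a hjr hx]
          have := h.mono hjr hr x
          omega
        · rw [hatY_c hjr hx0 hx]
          have := h.mono (show r ≤ j - 1 by omega) (by omega) x
          omega
      · rw [hV.c x y hx0 hx hy]
        have hnr : ¬ (f (x, y - 1) ≠ 0 ∧ f (x, y - 1) ≤ r) := fun hc => by
          have := (h.thr x (y - 1) r hr).1 hc
          omega
        rcases le_or_gt j r with hjr | hjr
        · rw [hatY_a hjr hx]
          have := h.mono hjr hr x
          split_ifs <;> omega
        · rw [hatY_c hjr hx0 hx]
          have := h.thr x (y - 1) (j - 1) (by omega)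
          split_ifs <;> omega
    · rw [hV.e x y hx hy0]
      have h1 := h.thr (x - 1) y r hr
      rcases le_or_gt j r with hjr | hjr
      · rw [hatY_b hjr hx]
        have := h.thr (x - 1) y j (by omega)
        split_ifs <;> omega
      · rw [hatY_d hjr hx]
        have := h.thr (x - 1) y (j - 1) (by omega)
        split_ifs <;> omega
  · intro x y
    rcases Nat.eq_zero_or_pos x with rfl | hx0
    · rw [hV.z1]; omega
    rcases Nat.eq_zero_or_pos y with rfl | hy0
    · rw [hV.z2]; omega
    rcases le_or_gt x d with hx | hx
    · rcases lt_trichotomy y (Y r x + 1) with hy | hy | hy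
      · rw [hV.a x y hx0 hx hy0 (by omega)]
        have := h.bd x y
        omega
      · rw [hV.b x y hx0 hx hy]; omega
      · rw [hV.c x y hx0 hx hy]
        have := h.bd x (y - 1)
        split_ifs <;> omega
    · rw [hV.e x y hx hy0]
      have := h.bd (x - 1) y
      split_ifs <;> omega

lemma hat_memC {i : ℤ} {n r : ℕ} {f : ℕ × ℕ → ℕ} (h : MemC i n f) (hn : 1 ≤ n)
    (hr : (r : ℤ) ≤ n + i) : MemC i (n + 1) (hatFun f n r) := by
  obtain ⟨Y, l, hc, hs, hl⟩ := memC_iff.1 h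
  have hrl : r ≤ l := by omega
  have hD := hatD_facts hc hs hn hrl
  refine memC_iff.2 ⟨_, _, hat_ch hc hs hn hrl, ?_, by push_cast; omega⟩
  intro x
  have h1 := hD.le
  rcases Nat.eq_zero_or_pos x with rfl | hx0
  · rw [hatY_0 (by omega)]; simp [dstair]
  rcases le_or_gt x (hatD f n r) with hx | hx
  · rw [hatY_c (by omega) hx0 hx]
    simp only [Nat.add_sub_cancel]
    rw [hs, dstair, dstair, if_neg (by omega), if_neg (by omega)]
    omega
  · rw [hatY_d (by omega) hx]
    have := hD.pos
    simp only [Nat.add_sub_cancel]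
    rw [hs, dstair, dstair, if_neg (by omega), if_neg (by omega)]
    omega

lemma hat_plus {i : ℤ} {n r : ℕ} {f : ℕ × ℕ → ℕ} (h : MemC i n f) (hn : 1 ≤ n)
    (hr : (r : ℤ) ≤ n + i) (hnp : ∀ j, 1 ≤ j → j ≤ r → ¬ HasPlusFullSet f n j) (j : ℕ) :
    HasPlusFullSet (hatFun f n r) (n + 1) j ↔ (j = r + 1 ∨ ∃ k, HasPlusFullSet f n k ∧ j = k + 1) := by
  have hgC := hat_memC h hn hr
  obtain ⟨Y, l, hc, hs, hl⟩ := memC_iff.1 h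
  have hrl : r ≤ l := by omega
  have hD := hatD_facts hc hs hn hrl
  have hV := hat_vals hc hs hn hrl
  have hgc := hat_ch hc hs hn hrl
  generalize hatD f n r = d at hD hV hgc
  generalize hatFun f n r = g at hV hgC hgc
  have hpos := hD.pos
  have hdn := hD.le
  -- row `d` has only small labels
  have hrowd : ∀ y, f (d, y) ≤ r := by
    intro y
    by_contra hcon
    have h4 := (hc.ne_zero d y).1 (by omega)
    rw [full_of_le hc hs hD hrl le_rfl, ← hD.full] at h4
    have := (hc.thr _ _ r hrl).2 h4
    omega
  -- transfer of small labels
  have s1 : ∀ x y v, 1 ≤ v → v ≤ r → x ≤ d → f (x, y) = v → g (x, y) = v := by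
    intro x y v h1 h2 h3 h4
    have h5 := (hc.thr x y r hrl).1 ⟨by omega, by omega⟩
    rw [hV.a x y h5.1 h3 h5.2.1 h5.2.2, h4]
  have s2 : ∀ x y v, 1 ≤ v → v ≤ r → d ≤ x → f (x, y) = v → g (x + 1, y) = v := by
    intro x y v h1 h2 h3 h4
    have h5 := (hc.thr x y r hrl).1 ⟨by omega, by omega⟩
    rw [hV.e (x + 1) y (by omega) h5.2.1]
    simp only [Nat.add_sub_cancel]
    rw [h4, if_pos h2]
  -- transfer of large labels
  have t1 : ∀ x y v, r < v → x ≤ d → f (x, y) = v → g (x, y + 1) = v + 1 := by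
    intro x y v h1 h2 h3
    have h5 := (hc.ne_zero x y).1 (by omega)
    have h6 : ¬ y ≤ Y r x := fun hcon => by
      have := (hc.thr x y r hrl).2 ⟨h5.1, h5.2.1, hcon⟩
      omega
    rw [hV.c x (y + 1) h5.1 h2 (by omega)]
    simp only [Nat.add_sub_cancel]
    rw [if_neg (by omega), h3]
  have t2 : ∀ x y v, r < v → d ≤ x → f (x, y) = v → g (x + 1, y) = v + 1 := by
    intro x y v h1 h2 h3
    have h5 := (hc.ne_zero x y).1 (by omega)
    rw [hV.e (x + 1) y (by omega) h5.2.1]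
    simp only [Nat.add_sub_cancel]
    rw [if_neg (by omega), h3]
  -- inversion
  have inv : ∀ x y v, g (x, y) = v → 1 ≤ v →
      (v ≤ r ∧ x ≤ d ∧ f (x, y) = v) ∨ (v ≤ r ∧ d < x ∧ f (x - 1, y) = v) ∨
      (v = r + 1 ∧ x ≤ d) ∨
      (r + 1 < v ∧ x ≤ d ∧ f (x, y - 1) = v - 1) ∨
      (r + 1 < v ∧ d < x ∧ f (x - 1, y) = v - 1) := by
    intro x y v hv h1
    rcases Nat.eq_zero_or_pos x with rfl | hx0
    · rw [hV.z1] at hv; omega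
    rcases Nat.eq_zero_or_pos y with rfl | hy0
    · rw [hV.z2] at hv; omega
    rcases le_or_gt x d with hx | hx
    · rcases lt_trichotomy y (Y r x + 1) with hy | hy | hy
      · rw [hV.a x y hx0 hx hy0 (by omega)] at hv
        have := (hc.thr x y r hrl).2 ⟨hx0, hy0, by omega⟩
        omega
      · rw [hV.b x y hx0 hx hy] at hv; omega
      · rw [hV.c x y hx0 hx hy] at hv
        have hnr : ¬ (f (x, y - 1) ≠ 0 ∧ f (x, y - 1) ≤ r) := fun hc' => by
          have := (hc.thr x (y - 1) r hrl).1 hc'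
          omega
        split_ifs at hv <;> omega
    · rw [hV.e x y hx hy0] at hv
      split_ifs at hv <;> omega
  -- diagonal values
  have d0 : ∀ k, 1 ≤ k → k ≤ n - 1 → 1 ≤ f (k, n - k) := by
    intro k h1 h2
    have := (hc.ne_zero k (n - k)).2 ⟨h1, by omega, by
      rw [hs, dstair, if_neg (by omega)]⟩
    omega
  have d1 : ∀ k, 1 ≤ k → k < d → r < f (k, n - k) := by
    intro k h1 h2
    have h3 := hD.lt k h1 h2
    have h4 := d0 k h1 (by omega)
    by_contra hcon
    have := (hc.thr k (n - k) r hrl).1 ⟨by omega, by omega⟩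
    omega
  have g1 : ∀ k, 1 ≤ k → k < d → g (k, n + 1 - k) = f (k, n - k) + 1 := by
    intro k h1 h2
    have := t1 k (n - k) _ (d1 k h1 h2) (by omega) rfl
    rw [← this]
    congr 2
    omega
  have g2 : g (d, n + 1 - d) = r + 1 := by
    apply hV.b d _ hpos le_rfl
    have := hD.full
    omega
  have g3 : ∀ k, d ≤ k → k ≤ n - 1 → g (k + 1, n - k) =
      if f (k, n - k) ≤ r then f (k, n - k) else f (k, n - k) + 1 := by
    intro k h1 h2
    exact hV.e (k + 1) (n - k) (by omega) (by omega)
  constructor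
  · rintro ⟨k, ⟨⟨y0, hy0⟩, hk1, hk2, hk3, hk4⟩, hk5⟩
    simp only [Nat.add_sub_cancel] at hk2 hk5
    have hj1 : 1 ≤ j := by
      rcases lt_trichotomy k d with hkd | hkd | hkd
      · rw [g1 k hk1 hkd] at hk3; omega
      · subst hkd; omega
      · have := g3 (k - 1) (by omega) (by omega)
        have h0 := d0 (k - 1) (by omega) (by omega)
        rw [show k - 1 + 1 = k by omega, show n - (k - 1) = n + 1 - k by omega] at this
        rw [show n - (k - 1) = n + 1 - k by omega] at h0
        split_ifs at this <;> omega
    rcases lt_trichotomy k d with hkd | hkd | hkd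
    · right
      have hg := g1 k hk1 hkd
      have hdk := d1 k hk1 hkd
      refine ⟨j - 1, ⟨k, ⟨?_, hk1, by omega, by omega, ?_⟩, ?_⟩, by omega⟩
      · refine ⟨y0 - 1, ?_⟩
        rcases inv 1 y0 j hy0 hj1 with h | h | h | h | h <;> omega
      · intro x y hxy
        by_contra hcon
        rcases le_or_gt x d with hx | hx
        · have := t1 x y _ (by omega) hx hxy
          have := hk4 x (y + 1) (by omega)
          omega
        · have := t2 x y _ (by omega) hx.le hxy
          have := hk4 (x + 1) y (by omega)
          omega
      · rcases (show k = n - 1 ∨ k ≤ n - 2 by omega) with h1 | h1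
        · exact Or.inl h1
        · right
          refine ⟨h1, ?_⟩
          rcases (show k + 1 = d ∨ k + 1 < d by omega) with h2 | h2
          · have := hrowd (n - k - 1)
            rw [h2]
            omega
          · have := g1 (k + 1) (by omega) h2
            rw [show n + 1 - (k + 1) = n + 1 - k - 1 by omega,
              show n - (k + 1) = n - k - 1 by omega] at this
            omega
    · left
      subst hkd
      omega
    · -- below row `d`
      have hg := g3 (k - 1) (by omega) (by omega)
      have h0 := d0 (k - 1) (by omega) (by omega)
      rw [show k - 1 + 1 = k by omega, show n - (k - 1) = n + 1 - k by omega] at hg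
      rw [show n - (k - 1) = n + 1 - k by omega] at h0
      rw [hk3] at hg
      by_cases hjr : f (k - 1, n + 1 - k) ≤ r
      · rw [if_pos hjr] at hg
        exfalso
        refine hnp j hj1 (by omega) ⟨k - 1, ⟨?_, by omega, by omega, ?_, ?_⟩, ?_⟩
        · refine ⟨y0, ?_⟩
          rcases inv 1 y0 j hy0 hj1 with h | h | h | h | h <;> omega
        · rw [show n - (k - 1) = n + 1 - k by omega]; omega
        · intro x y hxy
          rcases le_or_gt x d with hx | hx
          · omega
          · have := s2 x y j hj1 (by omega) hx.le hxy
            have := hk4 (x + 1) y this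
            omega
        · rcases (show k = n ∨ k ≤ n - 1 by omega) with h1 | h1
          · left; omega
          · right
            refine ⟨by omega, ?_⟩
            have h2 := g3 k (by omega) h1
            rw [show k - 1 + 1 = k by omega, show n - (k - 1) - 1 = n - k by omega]
            rw [show n + 1 - k - 1 = n - k by omega] at hk5
            split_ifs at h2 <;> omega
      · rw [if_neg hjr] at hg
        exfalso
        have h1 : f (1, y0 - 1) = j - 1 := by
          rcases inv 1 y0 j hy0 hj1 with h | h | h | h | h <;> omega
        obtain ⟨y, hy⟩ := hc.contig (j := j - 1) (by omega) h1
          (show f (k - 1, n + 1 - k) = j - 1 by omega) hpos (show d ≤ k - 1 by omega)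
        have := hrowd y
        omega
  · rintro (rfl | ⟨v, ⟨k, ⟨⟨y0, hy0⟩, hk1, hk2, hk3, hk4⟩, hk5⟩, rfl⟩)
    · refine ⟨d, ⟨⟨Y r 1 + 1, hV.b 1 _ le_rfl hpos rfl⟩, hpos, by omega, g2, ?_⟩, ?_⟩
      · intro x y hxy
        rcases inv x y _ hxy (by omega) with h | h | h | h | h <;> omega
      · rcases (show d = n ∨ d ≤ n - 1 by omega) with h1 | h1
        · left; omega
        · right
          refine ⟨by omega, ?_⟩
          have h2 := g3 d le_rfl h1
          have h3 := hrowd (n - d)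
          rw [if_pos h3] at h2
          rw [show n + 1 - d - 1 = n - d by omega, h2]
          omega
    · have hv1 := d0 k hk1 hk2
      have hvr : r < v := by
        by_contra hcon
        exact hnp v (by omega) (by omega) ⟨k, ⟨⟨y0, hy0⟩, hk1, hk2, hk3, hk4⟩, hk5⟩
      have hkd : k < d := by
        by_contra hcon
        obtain ⟨y, hy⟩ := hc.contig (j := v) (by omega) hy0 hk3 hpos (show d ≤ k by omega)
        have := hrowd y
        omega
      refine ⟨k, ⟨⟨y0 + 1, t1 1 y0 v hvr hpos hy0⟩, hk1, by omega, ?_, ?_⟩, ?_⟩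
      · rw [g1 k hk1 hkd, hk3]
      · intro x y hxy
        rcases inv x y _ hxy (by omega) with h | h | h | h | h
        · omega
        · omega
        · omega
        · exact hk4 x (y - 1) (by omega)
        · have := hk4 (x - 1) y (by omega)
          omega
      · right
        refine ⟨by omega, ?_⟩
        rw [show n + 1 - k - 1 = n + 1 - (k + 1) by omega]
        rcases (show k + 1 = d ∨ k + 1 < d by omega) with h2 | h2
        · rw [h2, g2]; omega
        · rw [g1 (k + 1) (by omega) h2]
          rcases hk5 with h5 | ⟨h5, h6⟩
          · omega
          · rw [show n - (k + 1) = n - k - 1 by omega]; omega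

lemma fin_gap {t : ℕ} {u : Fin t → ℕ} (hu : StrictMono u) (a : Fin t) (k : ℕ)
    (hk : (a : ℕ) + k < t) : u a + k ≤ u ⟨a + k, hk⟩ := by
  induction k with
  | zero => simp
  | succ k ih =>
    have h1 := ih (by omega)
    have h2 : u ⟨a + k, by omega⟩ < u ⟨a + (k + 1), hk⟩ := hu (by
      rw [Fin.lt_def]; simp only; omega)
    omega

lemma count_mono (M t : ℕ) :
    Nat.card {r : Fin t → ℕ // Monotone r ∧ ∀ j, r j ≤ M} = Nat.choose (M + t) t := by
  have e : {r : Fin t → ℕ // Monotone r ∧ ∀ j, r j ≤ M} ≃ (Fin t ↪o Fin (M + t)) :=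
    { toFun := fun r => OrderEmbedding.ofStrictMono
        (fun k => (⟨r.1 k + k, by have := r.2.2 k; have := k.2; omega⟩ : Fin (M + t)))
        (fun a b hab => by
          have h1 := r.2.1 hab.le
          rw [Fin.lt_def] at hab ⊢
          simp only
          omega)
      invFun := fun e => ⟨fun k => (e k : ℕ) - k, by
        have hu : StrictMono (fun k => (e k : ℕ)) := fun a b hab => e.strictMono hab
        constructor
        · intro a b hab
          rw [Fin.le_def] at hab
          have h1 := fin_gap hu a (b - a) (by have := b.2; omega)
          have h2 : (⟨(a : ℕ) + (b - a), by have := b.2; omega⟩ : Fin t) = b := by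
            ext; simp only; omega
          rw [h2] at h1
          simp only at h1 ⊢
          omega
        · intro j
          have h1 := fin_gap hu j (t - 1 - j) (by have := j.2; omega)
          have h2 := (e ⟨j + (t - 1 - j), by have := j.2; omega⟩).2
          have := j.2
          simp only at h1 ⊢
          omega⟩
      left_inv := by
        rintro ⟨r, hr⟩
        ext k
        change r k + (k : ℕ) - k = r k
        omega
      right_inv := by
        intro e
        have hu : StrictMono (fun k => (e k : ℕ)) := fun a b hab => e.strictMono hab
        ext k
        have h1 := fin_gap hu ⟨0, by have := k.2; omega⟩ k (by simp)
        simp only [Nat.zero_add] at h1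
        have h2 : (e k : ℕ) = (e ⟨(k : ℕ), k.2⟩ : ℕ) := rfl
        change (e k : ℕ) - k + k = e k
        omega }
  rw [Nat.card_congr (e.trans Set.powersetCard.ofFinEmbEquiv), Set.powersetCard.card]
  simp

/-- Invariant along the composition. -/
def Inv (i : ℤ) (m t : ℕ) (r : ℕ → ℕ) (D : ℕ → ℕ × ℕ → ℕ) (s : ℕ) : Prop :=
  MemC i (m + s) (D s) ∧
    ∀ j, HasPlusFullSet (D s) (m + s) j ↔ ∃ q, 1 ≤ q ∧ q ≤ s ∧ j = r (t - s + q) + q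

lemma inv_zero {i : ℤ} {m t : ℕ} {r : ℕ → ℕ} {D : ℕ → ℕ × ℕ → ℕ} (h : MemN i m (D 0)) :
    Inv i m t r D 0 := by
  refine ⟨h.1, fun j => ⟨fun hj => absurd hj (h.2 j), ?_⟩⟩
  rintro ⟨q, h1, h2, -⟩
  omega

lemma inv_step {i : ℤ} {m t s : ℕ} {r : ℕ → ℕ} {D : ℕ → ℕ × ℕ → ℕ} (hm : 1 ≤ m) (hs : s < t)
    (h : Inv i m t r D s) (hr : (r (t - s) : ℤ) ≤ (m : ℤ) + s + i)
    (hp : ∀ j, 1 ≤ j → j ≤ r (t - s) → ¬ HasPlusFullSet (D s) (m + s) j)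
    (hD : D (s + 1) = hatFun (D s) (m + s) (r (t - s))) : Inv i m t r D (s + 1) := by
  have hr' : (r (t - s) : ℤ) ≤ ((m + s : ℕ) : ℤ) + i := by push_cast; omega
  refine ⟨?_, ?_⟩
  · rw [hD]; exact hat_memC (n := m + s) h.1 (Nat.le_add_right_of_le hm) hr'
  · intro j
    rw [hD, ← Nat.add_assoc, hat_plus h.1 (by omega) hr' hp j]
    constructor
    · rintro (rfl | ⟨k, hk, rfl⟩)
      · exact ⟨1, le_rfl, by omega, by rw [show t - (s + 1) + 1 = t - s by omega]⟩
      · obtain ⟨q, h1, h2, rfl⟩ := (h.2 k).1 hk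
        exact ⟨q + 1, by omega, by omega, by
          rw [show t - (s + 1) + (q + 1) = t - s + q by omega]; omega⟩
    · rintro ⟨q, h1, h2, rfl⟩
      rcases Nat.eq_or_lt_of_le h1 with rfl | h1
      · left; rw [show t - (s + 1) + 1 = t - s by omega]
      · right
        refine ⟨r (t - s + (q - 1)) + (q - 1), (h.2 _).2 ⟨q - 1, by omega, by omega, rfl⟩, ?_⟩
        rw [show t - (s + 1) + q = t - s + (q - 1) by omega]; omega

lemma tuple_mono {t : ℕ} {r : ℕ → ℕ} (h : ∀ j, 1 ≤ j → j + 1 ≤ t → r j ≤ r (j + 1)) {a b : ℕ}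
    (ha : 1 ≤ a) (hab : a ≤ b) (hb : b ≤ t) : r a ≤ r b := by
  induction b, hab using Nat.le_induction with
  | base => exact le_rfl
  | succ k hk ih => exact (ih (by omega)).trans (h k (by omega) hb)

lemma repBy_inv {i : ℤ} {m t : ℕ} {r : ℕ → ℕ} {D : ℕ → ℕ × ℕ → ℕ} (hm : 1 ≤ m)
    (h0 : MemN i m (D 0))
    (h : ∀ s, s < t →
      MemC i (m + s) (D s) ∧
      ((r (t - s) : ℤ) ≤ (m : ℤ) + s + i) ∧
      (∀ j, 1 ≤ j → j ≤ r (t - s) → ¬ HasPlusFullSet (D s) (m + s) j) ∧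
      D (s + 1) = hatFun (D s) (m + s) (r (t - s))) (s : ℕ) (hs : s ≤ t) : Inv i m t r D s := by
  induction s with
  | zero => exact inv_zero h0
  | succ s ih =>
    obtain ⟨-, h2, h3, h4⟩ := h s (by omega)
    exact inv_step hm (by omega) (ih (by omega)) h2 h3 h4

/-- The iterated sequence. -/
def seqD (m t : ℕ) (r : ℕ → ℕ) (C0 : ℕ × ℕ → ℕ) : ℕ → ℕ × ℕ → ℕ
  | 0 => C0
  | s + 1 => hatFun (seqD m t r C0 s) (m + s) (r (t - s))

lemma exists_rep {i : ℤ} {m t : ℕ} {r : ℕ → ℕ} {C0 : ℕ × ℕ → ℕ} (hm : 1 ≤ m)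
    (h0 : MemN i m C0) (hmono : ∀ j, 1 ≤ j → j + 1 ≤ t → r j ≤ r (j + 1))
    (hb : (r t : ℤ) ≤ (m : ℤ) + i) : RepBy i m t r C0 (seqD m t r C0 t) := by
  have dom : ∀ s, s < t → Inv i m t r (seqD m t r C0) s →
      ((r (t - s) : ℤ) ≤ (m : ℤ) + s + i) ∧
      (∀ j, 1 ≤ j → j ≤ r (t - s) → ¬ HasPlusFullSet (seqD m t r C0 s) (m + s) j) := by
    intro s hs hI
    constructor
    · have := tuple_mono hmono (show 1 ≤ t - s by omega) (show t - s ≤ t by omega) le_rfl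
      omega
    · intro j hj1 hj2 hp
      obtain ⟨q, h1, h2, h3⟩ := (hI.2 j).1 hp
      have := tuple_mono hmono (show 1 ≤ t - s by omega) (show t - s ≤ t - s + q by omega)
        (by omega)
      omega
  have hI : ∀ s, s ≤ t → Inv i m t r (seqD m t r C0) s := by
    intro s
    induction s with
    | zero => intro _; exact inv_zero h0
    | succ s ih =>
      intro hs
      have h1 := ih (by omega)
      obtain ⟨h2, h3⟩ := dom s (by omega) h1
      exact inv_step hm (by omega) h1 h2 h3 rfl
  refine ⟨seqD m t r C0, rfl, rfl, fun s hs => ?_⟩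
  have h1 := hI s hs.le
  obtain ⟨h2, h3⟩ := dom s hs h1
  exact ⟨h1.1, h2, h3, rfl⟩

lemma tuple_fin_strict {t : ℕ} {r : ℕ → ℕ} (h : ∀ j, 1 ≤ j → j + 1 ≤ t → r j ≤ r (j + 1)) :
    StrictMono (fun k : Fin t => r (k + 1) + (k + 1)) := by
  intro a b hab
  rw [Fin.lt_def] at hab
  have := tuple_mono h (show 1 ≤ (a : ℕ) + 1 by omega) (show (a : ℕ) + 1 ≤ b + 1 by omega)
    (by have := b.2; omega)
  simp only
  omega

lemma tuple_fin_range {t : ℕ} (r : ℕ → ℕ) :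
    Set.range (fun k : Fin t => r (k + 1) + (k + 1)) =
      {v : ℕ | ∃ s, 1 ≤ s ∧ s ≤ t ∧ v = r s + s} := by
  ext v
  simp only [Set.mem_range, Set.mem_ofPred_eq]
  constructor
  · rintro ⟨k, rfl⟩
    exact ⟨k + 1, by omega, by have := k.2; omega, rfl⟩
  · rintro ⟨s, h1, h2, rfl⟩
    exact ⟨⟨s - 1, by omega⟩, by simp only [show s - 1 + 1 = s by omega]⟩

/-- **Proposition 5.5.**  Let `i ≥ -1`, `1 ≤ t ≤ n - 1` and `C̃ ∈ N_i(n - t)`.  A `t`-tuple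
`(r 1, …, r t)` yields a well-defined composition
`(φ_{i,n-1}^{r 1} ∘ ⋯ ∘ φ_{i,n-t}^{r t}) C̃` (each factor applied within its domain) if and only
if `0 ≤ r 1 ≤ r 2 ≤ ⋯ ≤ r t ≤ n - t + i`; the number of such `t`-tuples is `C(n+i, t)`.
Moreover, for such a `t`-tuple and `C` the value of the composition, the set
`{j : C has a j⁺-full-set}` equals `{r 1 + 1, r 2 + 2, …, r t + t}`, a `t`-element subset of
`[n+i]` uniquely determined by the tuple. -/
theorem tuple_characterization (i : ℤ) (hi : -1 ≤ i) (n t : ℕ) (ht1 : 1 ≤ t)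
    (ht2 : t ≤ n - 1) (C0 : ℕ × ℕ → ℕ) (hC0 : MemN i (n - t) C0) :
    (∀ r : ℕ → ℕ,
      (∃ C, RepBy i (n - t) t r C0 C) ↔
        ((∀ j, 1 ≤ j → j + 1 ≤ t → r j ≤ r (j + 1)) ∧ (r t : ℤ) ≤ (n : ℤ) - t + i)) ∧
    (Set.ncard {r : Fin t → ℕ | Monotone r ∧ ∀ j, (r j : ℤ) ≤ (n : ℤ) - t + i} =
      Nat.choose ((n : ℤ) + i).toNat t) ∧
    (∀ r : ℕ → ℕ, ∀ C : ℕ × ℕ → ℕ,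
      (∀ j, 1 ≤ j → j + 1 ≤ t → r j ≤ r (j + 1)) → (r t : ℤ) ≤ (n : ℤ) - t + i →
      RepBy i (n - t) t r C0 C →
        ({j : ℕ | HasPlusFullSet C n j} = {v : ℕ | ∃ s, 1 ≤ s ∧ s ≤ t ∧ v = r s + s} ∧
         Set.ncard {j : ℕ | HasPlusFullSet C n j} = t ∧
         (∀ j, HasPlusFullSet C n j → 1 ≤ j ∧ (j : ℤ) ≤ (n : ℤ) + i) ∧
         ∀ r' : ℕ → ℕ,
           (∀ j, 1 ≤ j → j + 1 ≤ t → r' j ≤ r' (j + 1)) →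
           {v : ℕ | ∃ s, 1 ≤ s ∧ s ≤ t ∧ v = r' s + s} =
             {v : ℕ | ∃ s, 1 ≤ s ∧ s ≤ t ∧ v = r s + s} →
           ∀ j, 1 ≤ j → j ≤ t → r' j = r j)) := by
  have hm : 1 ≤ n - t := by omega
  have hcast : ((n - t : ℕ) : ℤ) = (n : ℤ) - t := by omega
  refine ⟨?_, ?_, ?_⟩
  · intro r
    constructor
    · rintro ⟨C, D, hD0, hDt, hD⟩
      have hI := repBy_inv hm (by rw [hD0]; exact hC0) hD
      constructor
      · intro j hj1 hj2
        have h1 := hI (t - j) (by omega)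
        obtain ⟨-, -, h2, -⟩ := hD (t - j) (by omega)
        rw [show t - (t - j) = j by omega] at h2
        have h3 := (h1.2 (r (j + 1) + 1)).2 ⟨1, le_rfl, by omega, by
          rw [show t - (t - j) + 1 = j + 1 by omega]⟩
        by_contra hc
        exact h2 _ (by omega) (by omega) h3
      · obtain ⟨-, h2, -, -⟩ := hD 0 (by omega)
        simp only [Nat.sub_zero] at h2
        push_cast at h2
        omega
    · rintro ⟨h1, h2⟩
      exact ⟨_, exists_rep hm hC0 h1 (by omega)⟩
  · obtain ⟨M, hM⟩ : ∃ M : ℕ, (M : ℤ) = (n : ℤ) - t + i :=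
      ⟨((n : ℤ) - t + i).toNat, by omega⟩
    rw [show ((n : ℤ) + i).toNat = M + t by omega, ← count_mono M t, ← hM]
    simp only [Nat.cast_le]
    rfl
  · rintro r C hmono hb ⟨D, hD0, hDt, hD⟩
    have hI := repBy_inv hm (by rw [hD0]; exact hC0) hD t le_rfl
    have hset : {j : ℕ | HasPlusFullSet C n j} = {v : ℕ | ∃ s, 1 ≤ s ∧ s ≤ t ∧ v = r s + s} := by
      ext j
      have h1 := hI.2 j
      rw [hDt, show n - t + t = n by omega] at h1
      simpa using h1
    refine ⟨hset, ?_, ?_, ?_⟩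
    · rw [hset, ← tuple_fin_range, ← Set.image_univ,
        Set.ncard_image_of_injective _ (tuple_fin_strict hmono).injective, Set.ncard_univ]
      simp
    · intro j hj
      have h1 : j ∈ {j : ℕ | HasPlusFullSet C n j} := hj
      rw [hset] at h1
      obtain ⟨s, h2, h3, rfl⟩ := h1
      have := tuple_mono hmono h2 h3 le_rfl
      push_cast
      omega
    · intro r' hmono' heq j hj1 hj2
      rw [← tuple_fin_range, ← tuple_fin_range] at heq
      have h1 := congrFun (((tuple_fin_strict hmono').range_inj
        (tuple_fin_strict hmono)).1 heq) ⟨j - 1, by omega⟩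
      simp only [show j - 1 + 1 = j by omega] at h1
      omega

end TamariMaxChains
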